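/- Let V be a real vector space, a : V × V → ℝ a symmetric bilinear form, and W ⊆ V a linear subspace on which a is positive definite (a(w,w) > 0 for every nonzero w ∈ W). Fix d ∈ ℕ, elements x_1, …, x_d ∈ V, and ψ^1, …, ψ^d ∈ W with a(x_j + ψ^j, z) = 0 for all z ∈ W and all j. Let c, e ∈ ℝ^d, set u_H := Σ_j c_j x_j and v_H := Σ_j e_j x_j, and suppose u^m, v^m ∈ V satisfy u^m − u_H ∈ W, v^m − v_H ∈ W, a(u^m, z) = 0 and a(v^m, z) = 0 for all z ∈ W. Then a(u^m, v^m) = Σ_{j,k=1}^d a(x_k + ψ^k, x_j + ψ^j) c_k e_j. -/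

import Mathlib

/-- A vector that differs from `∑ j, c j • x j` by an element of `W` and is orthogonal to `W` is
the same combination of the corrected vectors `x j + ψ j`. -/
theorem eq_sum_smul_corrected {ι V : Type*} [Fintype ι] [AddCommGroup V] [Module ℝ V]
    (a : V →ₗ[ℝ] V →ₗ[ℝ] ℝ) (W : Submodule ℝ V)
    (hpos : ∀ w ∈ W, w ≠ 0 → 0 < a w w) (x ψ : ι → V) (hψW : ∀ j, ψ j ∈ W)
    (hcorr : ∀ j, ∀ z ∈ W, a (x j + ψ j) z = 0) (c : ι → ℝ) (u : V)
    (huW : u - ∑ j, c j • x j ∈ W) (hu : ∀ z ∈ W, a u z = 0) :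
    u = ∑ j, c j • (x j + ψ j) := by
  have hW : u - ∑ j, c j • (x j + ψ j) ∈ W := by
    simp only [smul_add, Finset.sum_add_distrib, ← sub_sub]
    exact W.sub_mem huW (W.sum_mem fun j _ => W.smul_mem _ (hψW j))
  have horth : ∀ z ∈ W, a (u - ∑ j, c j • (x j + ψ j)) z = 0 := by
    intro z hz
    simp only [map_sub, map_sum, map_smul, LinearMap.sub_apply, LinearMap.sum_apply,
      LinearMap.smul_apply, hu z hz, hcorr _ z hz, smul_zero, Finset.sum_const_zero, sub_zero]
  by_contra hne
  exact (hpos _ hW (sub_ne_zero.mpr hne)).ne' (horth _ hW)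

/-- Abstract content of the paper's Proposition 4.7 (equation (4.9)): the micro
bilinear form evaluated at the micro solutions equals the recovered homogenized
tensor applied to the constant macro gradients. -/
theorem stmt_5
    {V : Type*} [AddCommGroup V] [Module ℝ V]
    (a : V →ₗ[ℝ] V →ₗ[ℝ] ℝ)
    (hsymm : ∀ u v : V, a u v = a v u)
    (W : Submodule ℝ V)
    (hpos : ∀ w ∈ W, w ≠ 0 → 0 < a w w)
    (d : ℕ) (x ψ : Fin d → V)
    (hψW : ∀ j, ψ j ∈ W)
    (hcorr : ∀ j, ∀ z ∈ W, a (x j + ψ j) z = 0)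
    (c e : Fin d → ℝ)
    (uH vH : V)
    (huH : uH = ∑ j, c j • x j) (hvH : vH = ∑ j, e j • x j)
    (um vm : V)
    (humW : um - uH ∈ W) (hvmW : vm - vH ∈ W)
    (hum : ∀ z ∈ W, a um z = 0) (hvm : ∀ z ∈ W, a vm z = 0) :
    a um vm = ∑ j, ∑ k, a (x k + ψ k) (x j + ψ j) * c k * e j := by
  subst huH hvH
  rw [eq_sum_smul_corrected a W hpos x ψ hψW hcorr c um humW hum,
    eq_sum_smul_corrected a W hpos x ψ hψW hcorr e vm hvmW hvm]
  simp only [map_sum, map_smul, LinearMap.sum_apply, LinearMap.smul_apply, smul_eq_mul,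
    Finset.mul_sum]
  exact Finset.sum_congr rfl fun j _ => Finset.sum_congr rfl fun k _ => by ring
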